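/- arXiv:1702.07920 — 6 statements merged into one kernel-verified Lean document; each statement's English description precedes it below -/
import Mathlib

section
/- Let g ∈ ℝ³ be a fixed vector, let δR be a 3×3 real matrix with δRᵀ·δR = I₃ and δR·g = g, and let θ₂ ∈ ℝ³. Suppose differentiable functions R : ℝ → Matrix(3,3,ℝ) and v, p, f : ℝ → ℝ³, together with constant vectors b_g, b_a ∈ ℝ³ and continuous inputs w, a : ℝ → ℝ³, satisfy the noise-free VINS motion model: R'(t) = R(t)·S(w(t) − b_g), v'(t) = R(t)·(a(t) − b_a) + g, p'(t) = v(t), f'(t) = 0 for all t. Then the transformed functions R_Y(t) := δR·R(t), v_Y(t) := δR·v(t), p_Y(t) := δR·p(t) + θ₂, f_Y(t) := δR·f(t) + θ₂ (with the same biases b_g, b_a) satisfy the same system of differential equations, and moreover the system output is unchanged: R_Y(t)ᵀ·(f_Y(t) − p_Y(t)) = R(t)ᵀ·(f(t) − p(t)) for all t. -/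
open Matrix

attribute [local instance] Matrix.normedAddCommGroup Matrix.normedSpace

/-- `Smat x` is the 3×3 skew-symmetric matrix with `(Smat x).mulVec y = x ×₃ y`. -/
def Smat (x : Fin 3 → ℝ) : Matrix (Fin 3) (Fin 3) ℝ :=
  !![0, -x 2, x 1; x 2, 0, -x 0; -x 1, x 0, 0]

theorem HasDerivAt.const_matrix_mulVec {m n : Type*} [Fintype m] [Fintype n]
    (A : Matrix m n ℝ) {u : ℝ → n → ℝ} {u' : n → ℝ} {t : ℝ} (hu : HasDerivAt u u' t) :
    HasDerivAt (fun s => A.mulVec (u s)) (A.mulVec u') t :=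
  (LinearMap.toContinuousLinearMap A.mulVecLin).hasFDerivAt.comp_hasDerivAt t hu

theorem HasDerivAt.const_matrix_mul {l m n : Type*} [Fintype l] [Fintype m] [Fintype n]
    (A : Matrix l m ℝ) {M : ℝ → Matrix m n ℝ} {M' : Matrix m n ℝ} {t : ℝ}
    (hM : HasDerivAt M M' t) : HasDerivAt (fun s => A * M s) (A * M') t :=
  (LinearMap.toContinuousLinearMap (mulLeftLinearMap n ℝ A)).hasFDerivAt.comp_hasDerivAt t hM

/-- Invariance of the noise-free VINS system under a rotation `δR` fixing the
gravity vector `g` together with a translation `θ₂`. -/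
theorem vins_deterministic_invariance
    (g θ₂ : Fin 3 → ℝ) (δR : Matrix (Fin 3) (Fin 3) ℝ)
    (hδR : δRᵀ * δR = 1) (hδRg : δR.mulVec g = g)
    (R : ℝ → Matrix (Fin 3) (Fin 3) ℝ) (v p f : ℝ → Fin 3 → ℝ)
    (bg ba : Fin 3 → ℝ) (w a : ℝ → Fin 3 → ℝ)
    (hw : Continuous w) (ha : Continuous a)
    (hR : ∀ t, HasDerivAt R (R t * Smat (w t - bg)) t)
    (hv : ∀ t, HasDerivAt v ((R t).mulVec (a t - ba) + g) t)
    (hp : ∀ t, HasDerivAt p (v t) t)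
    (hf : ∀ t, HasDerivAt f 0 t) :
    (∀ t, HasDerivAt (fun s => δR * R s) ((δR * R t) * Smat (w t - bg)) t) ∧
    (∀ t, HasDerivAt (fun s => δR.mulVec (v s))
      ((δR * R t).mulVec (a t - ba) + g) t) ∧
    (∀ t, HasDerivAt (fun s => δR.mulVec (p s) + θ₂) (δR.mulVec (v t)) t) ∧
    (∀ t, HasDerivAt (fun s => δR.mulVec (f s) + θ₂) 0 t) ∧
    (∀ t, (δR * R t)ᵀ.mulVec ((δR.mulVec (f t) + θ₂) - (δR.mulVec (p t) + θ₂)) =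
      (R t)ᵀ.mulVec (f t - p t)) := by
  refine ⟨fun t => ?_, fun t => ?_, fun t => ?_, fun t => ?_, fun t => ?_⟩
  · rw [Matrix.mul_assoc]
    exact (hR t).const_matrix_mul δR
  · have h := (hv t).const_matrix_mulVec δR
    rwa [Matrix.mulVec_add, Matrix.mulVec_mulVec, hδRg] at h
  · exact ((hp t).const_matrix_mulVec δR).add_const θ₂
  · simpa only [Matrix.mulVec_zero] using ((hf t).const_matrix_mulVec δR).add_const θ₂
  · rw [add_sub_add_right_eq_sub, ← Matrix.mulVec_sub, Matrix.mulVec_mulVec,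
      Matrix.transpose_mul, Matrix.mul_assoc, hδR, Matrix.mul_one]
end

section
/- Let R be a 3×3 real matrix with Rᵀ·R = I₃ and det R = 1. Then for every nonzero y ∈ ℝ³, the right Jacobian is equivariant under rotation: J_r(R·y) = R·J_r(y)·Rᵀ. -/
open Matrix

/-- The Euclidean norm of a vector in ℝ³. -/
noncomputable def enorm3 (y : Fin 3 → ℝ) : ℝ :=
  Real.sqrt (y 0 ^ 2 + y 1 ^ 2 + y 2 ^ 2)

/-- The right Jacobian of SO(3) (eq. (31)). -/
noncomputable def Jr (y : Fin 3 → ℝ) : Matrix (Fin 3) (Fin 3) ℝ :=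
  1 - ((1 - Real.cos (enorm3 y)) / enorm3 y ^ 2) • Smat y
    + ((enorm3 y - Real.sin (enorm3 y)) / enorm3 y ^ 3) • (Smat y * Smat y)

/-- Cofactor identity: `Mᵀ S(M x) M = det M • S(x)` for every 3×3 matrix `M`. -/
lemma transpose_mul_Smat_mulVec_mul (M : Matrix (Fin 3) (Fin 3) ℝ) (x : Fin 3 → ℝ) :
    Mᵀ * Smat (M *ᵥ x) * M = M.det • Smat x := by
  ext i j
  fin_cases i <;> fin_cases j <;>
    simp [Smat, Matrix.mul_apply, Matrix.mulVec, dotProduct, Fin.sum_univ_three,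
      Matrix.det_fin_three] <;> ring

lemma Smat_mulVec_of_rotation {R : Matrix (Fin 3) (Fin 3) ℝ} (hR : Rᵀ * R = 1)
    (hdet : R.det = 1) (y : Fin 3 → ℝ) : Smat (R *ᵥ y) = R * Smat y * Rᵀ := by
  have hR' : R * Rᵀ = 1 := mul_eq_one_comm.mp hR
  rw [← one_smul ℝ (Smat y), ← hdet, ← transpose_mul_Smat_mulVec_mul]
  calc Smat (R *ᵥ y) = (R * Rᵀ) * Smat (R *ᵥ y) * (R * Rᵀ) := by simp [hR']
    _ = R * (Rᵀ * Smat (R *ᵥ y) * R) * Rᵀ := by simp only [mul_assoc]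

lemma enorm3_eq_sqrt_dotProduct (y : Fin 3 → ℝ) : enorm3 y = Real.sqrt (y ⬝ᵥ y) := by
  simp only [enorm3, dotProduct, Fin.sum_univ_three, sq]

lemma enorm3_mulVec_of_orthogonal {R : Matrix (Fin 3) (Fin 3) ℝ} (hR : Rᵀ * R = 1)
    (y : Fin 3 → ℝ) : enorm3 (R *ᵥ y) = enorm3 y := by
  rw [enorm3_eq_sqrt_dotProduct, enorm3_eq_sqrt_dotProduct, dotProduct_mulVec,
    ← mulVec_transpose, mulVec_mulVec, hR, one_mulVec]

/-- The right Jacobian is equivariant under rotations: for a rotation matrix `R`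
and nonzero `y`, `J_r (R·y) = R · J_r y · Rᵀ`. -/
theorem rightJacobian_equivariance
    (R : Matrix (Fin 3) (Fin 3) ℝ) (hR : Rᵀ * R = 1) (hdet : R.det = 1)
    (y : Fin 3 → ℝ) (hy : y ≠ 0) :
    Jr (R.mulVec y) = R * Jr y * Rᵀ := by
  have hR' : R * Rᵀ = 1 := mul_eq_one_comm.mp hR
  have hsq : R * Smat y * Rᵀ * (R * Smat y * Rᵀ) = R * (Smat y * Smat y) * Rᵀ := by
    calc _ = R * Smat y * (Rᵀ * R) * Smat y * Rᵀ := by simp only [mul_assoc]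
      _ = _ := by simp only [hR, mul_one, mul_assoc]
  simp only [Jr, enorm3_mulVec_of_orthogonal hR, Smat_mulVec_of_rotation hR hdet, hsq,
    mul_add, mul_sub, add_mul, sub_mul, mul_one, hR', Matrix.mul_smul, Matrix.smul_mul]
end

section
/- (The RIEKF state-transition matrix preserves the unobservable directions: Φ_i·N_i = N_{i+1}, eq. (27)–(28).) Let g ∈ ℝ³ and let R̂, v̂, p̂ : ℝ → (3×3 matrices, resp. ℝ³) be continuous, with R̂(t) a 3×3 real matrix and v̂(t), p̂(t) ∈ ℝ³ for each t. Define F(t) as the 18×18 real matrix composed of 3×3 blocks (block rows/columns ordered θ, v, p, b_g, b_a, f): block row 1 = [0, 0, 0, −R̂(t), 0, 0]; block row 2 = [S(g), 0, 0, −S(v̂(t))·R̂(t), −R̂(t), 0]; block row 3 = [0, I₃, 0, −S(p̂(t))·R̂(t), 0, 0]; block rows 4, 5, 6 = 0. Define the 18×4 matrix N with 3×1 and 3×3 blocks: block rows (g, 0₃ₓ₃), (0, 0₃ₓ₃), (0, I₃), (0, 0₃ₓ₃), (0, 0₃ₓ₃), (0, I₃). If Φ : ℝ → Matrix(18,18,ℝ)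 is differentiable with Φ'(t) = F(t)·Φ(t) for all t and Φ(t₀)·N = N, then Φ(t)·N = N for all t. -/
open Matrix

attribute [local instance] Matrix.normedAddCommGroup Matrix.normedSpace

/-- The 3×3 block in block-row `i` and block-column `j` of the RIEKF propagation
Jacobian `F` (eq. (21)); blocks ordered `θ, v, p, b_g, b_a, f`. -/
def Fblock (g : Fin 3 → ℝ) (R : Matrix (Fin 3) (Fin 3) ℝ) (v p : Fin 3 → ℝ)
    (i j : Fin 6) : Matrix (Fin 3) (Fin 3) ℝ :=
  if i = 0 then (if j = 3 then -R else 0)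
  else if i = 1 then
    (if j = 0 then Smat g else if j = 3 then -(Smat v * R)
     else if j = 4 then -R else 0)
  else if i = 2 then (if j = 1 then 1 else if j = 3 then -(Smat p * R) else 0)
  else 0

/-- The 18×18 RIEKF propagation Jacobian `F(t)` (eq. (21)), indexed by
block index × inner index. -/
def Fmat (g : Fin 3 → ℝ) (Rhat : ℝ → Matrix (Fin 3) (Fin 3) ℝ)
    (vhat phat : ℝ → Fin 3 → ℝ) (t : ℝ) :
    Matrix (Fin 6 × Fin 3) (Fin 6 × Fin 3) ℝ :=
  fun q r => Fblock g (Rhat t) (vhat t) (phat t) q.1 r.1 q.2 r.2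

/-- The 18×4 matrix `N` (eq. (28)) spanning the unobservable directions, with
block rows `(g, 0), (0, 0), (0, I₃), (0, 0), (0, 0), (0, I₃)`. -/
def Nmat (g : Fin 3 → ℝ) : Matrix (Fin 6 × Fin 3) (Fin 4) ℝ :=
  fun q c =>
    if c = 0 then (if q.1 = 0 then g q.2 else 0)
    else if q.1 = 2 ∨ q.1 = 5 then (if ((q.2 : ℕ) + 1 = (c : ℕ)) then 1 else 0)
    else 0

theorem Fmat_mul_Nmat (g : Fin 3 → ℝ) (Rhat : ℝ → Matrix (Fin 3) (Fin 3) ℝ)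
    (vhat phat : ℝ → Fin 3 → ℝ) (t : ℝ) : Fmat g Rhat vhat phat t * Nmat g = 0 := by
  ext ⟨i, a⟩ c
  rw [Matrix.mul_apply, Fintype.sum_prod_type]
  by_cases hc : c = 0
  · subst hc
    fin_cases i <;> fin_cases a <;>
      simp [Fmat, Fblock, Nmat, Smat, Fin.sum_univ_succ] <;> ring
  · fin_cases i <;> simp [Fmat, Fblock, Nmat, hc, Fin.sum_univ_succ]

theorem hasDerivAt_mul_const_entry {m n k : Type*} [Fintype m] [Fintype n]
    {A : ℝ → Matrix m n ℝ} {A' : Matrix m n ℝ} {t : ℝ} (h : HasDerivAt A A' t)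
    (B : Matrix n k ℝ) (i : m) (j : k) :
    HasDerivAt (fun s => (A s * B) i j) ((A' * B) i j) t := by
  simp only [Matrix.mul_apply]
  exact HasDerivAt.fun_sum fun l _ =>
    (hasDerivAt_pi.1 (hasDerivAt_pi.1 h i) l).mul_const (B l j)

/-- For a solution of `Y' = F Y` vanishing at `t₀`, a block row of `Y` vanishes identically as
soon as all block rows entering its derivative do. -/
theorem block_row_eq_zero {g : Fin 3 → ℝ} {Rhat : ℝ → Matrix (Fin 3) (Fin 3) ℝ}
    {vhat phat : ℝ → Fin 3 → ℝ} {k : Type*} {Y : ℝ → Matrix (Fin 6 × Fin 3) k ℝ} {t₀ : ℝ}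
    (hY : ∀ t q c, HasDerivAt (fun s => Y s q c) ((Fmat g Rhat vhat phat t * Y t) q c) t)
    (h₀ : Y t₀ = 0) (i : Fin 6)
    (h : ∀ j, (∀ t, Fblock g (Rhat t) (vhat t) (phat t) i j = 0) ∨ ∀ t a c, Y t (j, a) c = 0) :
    ∀ t a c, Y t (i, a) c = 0 := by
  intro t a c
  have hd : ∀ s, HasDerivAt (fun s => Y s (i, a) c) 0 s := fun s => by
    convert hY s (i, a) c using 1
    rw [Matrix.mul_apply, eq_comm]
    refine Finset.sum_eq_zero fun ⟨j, b⟩ _ => ?_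
    rcases h j with hj | hj
    · simp [Fmat, hj]
    · simp [hj]
  have hconst := is_const_of_deriv_eq_zero (fun s => (hd s).differentiableAt)
    (fun s => (hd s).deriv) t t₀
  simpa [h₀] using hconst

/-- The RIEKF state-transition matrix preserves the unobservable directions:
if `Φ' = F·Φ` and `Φ(t₀)·N = N`, then `Φ(t)·N = N` for all `t`
(so that `Φ_i·N_i = N_{i+1}`, eqs. (27)–(28)). -/
theorem riekf_transition_preserves_unobservable_directions
    (g : Fin 3 → ℝ) (Rhat : ℝ → Matrix (Fin 3) (Fin 3) ℝ)
    (vhat phat : ℝ → Fin 3 → ℝ)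
    (hRc : Continuous Rhat) (hvc : Continuous vhat) (hpc : Continuous phat)
    (Φ : ℝ → Matrix (Fin 6 × Fin 3) (Fin 6 × Fin 3) ℝ) (t₀ : ℝ)
    (hΦ : ∀ t, HasDerivAt Φ (Fmat g Rhat vhat phat t * Φ t) t)
    (hinit : Φ t₀ * Nmat g = Nmat g) :
    ∀ t, Φ t * Nmat g = Nmat g := by
  have hY : ∀ t q c, HasDerivAt (fun s => (Φ s * Nmat g - Nmat g) q c)
      ((Fmat g Rhat vhat phat t * (Φ t * Nmat g - Nmat g)) q c) t := fun t q c => by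
    rw [Matrix.mul_sub, Fmat_mul_Nmat, sub_zero, ← Matrix.mul_assoc]
    exact (hasDerivAt_mul_const_entry (hΦ t) (Nmat g) q c).sub_const (Nmat g q c)
  have step := block_row_eq_zero (Y := fun s => Φ s * Nmat g - Nmat g) hY (sub_eq_zero.2 hinit)
  have hbg := step 3 fun j => .inl fun t => by simp [Fblock]
  have hba := step 4 fun j => .inl fun t => by simp [Fblock]
  have hf := step 5 fun j => .inl fun t => by simp [Fblock]
  have hθ := step 0 fun j => by
    by_cases hj : j = 3
    · exact .inr (hj ▸ hbg)
    · exact .inl fun t => by simp [Fblock, hj]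
  have hv := step 1 fun j => by
    by_cases h0 : j = 0
    · exact .inr (h0 ▸ hθ)
    by_cases h3 : j = 3
    · exact .inr (h3 ▸ hbg)
    by_cases h4 : j = 4
    · exact .inr (h4 ▸ hba)
    exact .inl fun t => by simp [Fblock, h0, h3, h4]
  have hp := step 2 fun j => by
    by_cases h1 : j = 1
    · exact .inr (h1 ▸ hv)
    by_cases h3 : j = 3
    · exact .inr (h3 ▸ hbg)
    exact .inl fun t => by simp [Fblock, h1, h3]
  intro t
  refine sub_eq_zero.1 (Matrix.ext fun ⟨i, a⟩ c => ?_)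
  fin_cases i
  exacts [hθ t a c, hv t a c, hp t a c, hbg t a c, hba t a c, hf t a c]
end

section
/- (Structure of the RIEKF state-transition matrix, eq. (27).) Let g ∈ ℝ³ and let F(t) be the 18×18 block matrix of the RIEKF linearized propagation model (block rows/columns ordered θ, v, p, b_g, b_a, f): block row 1 = [0, 0, 0, −R̂(t), 0, 0]; block row 2 = [S(g), 0, 0, −S(v̂(t))·R̂(t), −R̂(t), 0]; block row 3 = [0, I₃, 0, −S(p̂(t))·R̂(t), 0, 0]; block rows 4, 5, 6 = 0, where R̂, v̂, p̂ are continuous. If Φ : ℝ → Matrix(18,18,ℝ) is differentiable with Φ'(t) = F(t)·Φ(t) for all t and Φ(t₀) = I₁₈, then for all t: the first block column of Φ(t) equals (I₃, (t−t₀)·S(g), ((t−t₀)²/2)·S(g), 0, 0, 0), the third block column equals (0, 0, I₃, 0, 0, 0), and the sixth block column equals (0, 0, 0, 0, 0, I₃) (each entry a 3×3 block). -/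
open Matrix

attribute [local instance] Matrix.normedAddCommGroup Matrix.normedSpace

theorem eq_of_hasDerivAt_eq_of_eq_at {f h f' : ℝ → ℝ} {t₀ : ℝ}
    (hf : ∀ t, HasDerivAt f (f' t) t) (hh : ∀ t, HasDerivAt h (f' t) t)
    (h₀ : f t₀ = h t₀) (t : ℝ) : f t = h t := by
  have hd : ∀ s, HasDerivAt (f - h) 0 s := fun s => by
    simpa using (hf s).sub (hh s)
  have key := is_const_of_deriv_eq_zero (fun s => (hd s).differentiableAt)
    (fun s => (hd s).deriv) t t₀
  simp only [Pi.sub_apply] at key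
  linarith

section TransitionMatrix

variable {g : Fin 3 → ℝ} {Rhat : ℝ → Matrix (Fin 3) (Fin 3) ℝ}
  {vhat phat : ℝ → Fin 3 → ℝ}
  {Φ : ℝ → Matrix (Fin 6 × Fin 3) (Fin 6 × Fin 3) ℝ} {t₀ : ℝ}

theorem hasDerivAt_transition_entry
    (hΦ : ∀ t, HasDerivAt Φ (Fmat g Rhat vhat phat t * Φ t) t)
    (i : Fin 6) (a : Fin 3) (r : Fin 6 × Fin 3) (t : ℝ) :
    HasDerivAt (fun s => Φ s (i, a) r)
      (∑ j, ∑ k, Fblock g (Rhat t) (vhat t) (phat t) i j a k * Φ t (j, k) r) t := by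
  have h := hasDerivAt_pi.1 (hasDerivAt_pi.1 (hΦ t) (i, a)) r
  rwa [Matrix.mul_apply, Fintype.sum_prod_type] at h

theorem transition_bias_feature_row
    (hΦ : ∀ t, HasDerivAt Φ (Fmat g Rhat vhat phat t * Φ t) t) (hinit : Φ t₀ = 1)
    {i : Fin 6} (hi : i = 3 ∨ i = 4 ∨ i = 5) (a : Fin 3) (r : Fin 6 × Fin 3) (t : ℝ) :
    Φ t (i, a) r = (1 : Matrix (Fin 6 × Fin 3) (Fin 6 × Fin 3) ℝ) (i, a) r := by
  refine eq_of_hasDerivAt_eq_of_eq_at (f := fun s => Φ s (i, a) r) (t₀ := t₀)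
    (f' := fun _ => 0) (fun s => ?_)
    (fun s => hasDerivAt_const s _) (by simp only [hinit]) t
  convert hasDerivAt_transition_entry hΦ i a r s using 1
  rcases hi with rfl | rfl | rfl <;> simp [Fblock]

theorem transition_bias_row_eq_zero
    (hΦ : ∀ t, HasDerivAt Φ (Fmat g Rhat vhat phat t * Φ t) t) (hinit : Φ t₀ = 1)
    {i j : Fin 6} (hi : i = 3 ∨ i = 4) (hj : j ≠ 3 ∧ j ≠ 4) (a b : Fin 3) (t : ℝ) :
    Φ t (i, a) (j, b) = 0 := by
  rw [transition_bias_feature_row hΦ hinit (by tauto), Matrix.one_apply_ne]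
  rintro h
  simp only [Prod.mk.injEq] at h
  rcases hi with rfl | rfl <;> simp [← h.1] at hj

theorem transition_rotation_row
    (hΦ : ∀ t, HasDerivAt Φ (Fmat g Rhat vhat phat t * Φ t) t) (hinit : Φ t₀ = 1)
    {j : Fin 6} (hj : j ≠ 3 ∧ j ≠ 4) (a b : Fin 3) (t : ℝ) :
    Φ t (0, a) (j, b) = (1 : Matrix (Fin 6 × Fin 3) (Fin 6 × Fin 3) ℝ) (0, a) (j, b) := by
  refine eq_of_hasDerivAt_eq_of_eq_at (f := fun s => Φ s (0, a) (j, b)) (t₀ := t₀)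
    (f' := fun _ => 0) (fun s => ?_)
    (fun s => hasDerivAt_const s _) (by simp only [hinit]) t
  convert hasDerivAt_transition_entry hΦ 0 a (j, b) s using 1
  simp [Fblock, Fin.sum_univ_six,
    fun k => transition_bias_row_eq_zero hΦ hinit (Or.inl rfl) hj k b s]

theorem transition_velocity_row
    (hΦ : ∀ t, HasDerivAt Φ (Fmat g Rhat vhat phat t * Φ t) t) (hinit : Φ t₀ = 1)
    {j : Fin 6} (hj : j ≠ 3 ∧ j ≠ 4) (a b : Fin 3) (t : ℝ) :
    Φ t (1, a) (j, b) =
      (1 : Matrix (Fin 6 × Fin 3) (Fin 6 × Fin 3) ℝ) (1, a) (j, b) +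
      (t - t₀) * ∑ k, Smat g a k *
        (1 : Matrix (Fin 6 × Fin 3) (Fin 6 × Fin 3) ℝ) (0, k) (j, b) := by
  refine eq_of_hasDerivAt_eq_of_eq_at (f := fun s => Φ s (1, a) (j, b)) (t₀ := t₀)
    (fun s => ?_)
    (fun s => (((hasDerivAt_id s).sub_const t₀).mul_const _).const_add _)
    (by simp [hinit]) t
  convert hasDerivAt_transition_entry hΦ 1 a (j, b) s using 1
  simp [Fblock, Fin.sum_univ_six,
    fun k => transition_bias_row_eq_zero hΦ hinit (Or.inl rfl) hj k b s,
    fun k => transition_bias_row_eq_zero hΦ hinit (Or.inr rfl) hj k b s,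
    fun k => transition_rotation_row hΦ hinit hj k b s]

theorem transition_position_row
    (hΦ : ∀ t, HasDerivAt Φ (Fmat g Rhat vhat phat t * Φ t) t) (hinit : Φ t₀ = 1)
    {j : Fin 6} (hj : j ≠ 3 ∧ j ≠ 4) (a b : Fin 3) (t : ℝ) :
    Φ t (2, a) (j, b) =
      (1 : Matrix (Fin 6 × Fin 3) (Fin 6 × Fin 3) ℝ) (2, a) (j, b) +
      ((t - t₀) * (1 : Matrix (Fin 6 × Fin 3) (Fin 6 × Fin 3) ℝ) (1, a) (j, b) +
      (t - t₀) ^ 2 / 2 * ∑ k, Smat g a k *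
        (1 : Matrix (Fin 6 × Fin 3) (Fin 6 × Fin 3) ℝ) (0, k) (j, b)) := by
  refine eq_of_hasDerivAt_eq_of_eq_at (f := fun s => Φ s (2, a) (j, b)) (t₀ := t₀)
    (fun s => ?_)
    (fun s => ((((hasDerivAt_id s).sub_const t₀).mul_const _).add
      (((((hasDerivAt_id s).sub_const t₀).pow 2).div_const 2).mul_const _)).const_add _)
    (by simp [hinit]) t
  convert hasDerivAt_transition_entry hΦ 2 a (j, b) s using 1
  have hrow : ∑ k, (1 : Matrix (Fin 3) (Fin 3) ℝ) a k * Φ s (1, k) (j, b) =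
      Φ s (1, a) (j, b) := by
    simp [Matrix.one_apply]
  simp [Fblock, Fin.sum_univ_six, hrow,
    fun k => transition_bias_row_eq_zero hΦ hinit (Or.inl rfl) hj k b s,
    transition_velocity_row hΦ hinit hj a b s]

theorem transition_position_feature_column
    (hΦ : ∀ t, HasDerivAt Φ (Fmat g Rhat vhat phat t * Φ t) t) (hinit : Φ t₀ = 1)
    {j : Fin 6} (hj : j = 2 ∨ j = 5) (i : Fin 6) (a b : Fin 3) (t : ℝ) :
    Φ t (i, a) (j, b) = (if i = j then (1 : Matrix (Fin 3) (Fin 3) ℝ) else 0) a b := by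
  have hj' : j ≠ 3 ∧ j ≠ 4 := by rcases hj with rfl | rfl <;> decide
  have hcases : i = 0 ∨ i = 1 ∨ i = 2 ∨ i = 3 ∨ i = 4 ∨ i = 5 := by
    fin_cases i <;> simp
  have hone : Φ t (i, a) (j, b) =
      (1 : Matrix (Fin 6 × Fin 3) (Fin 6 × Fin 3) ℝ) (i, a) (j, b) := by
    rcases hcases with rfl | rfl | rfl | hi
    · exact transition_rotation_row hΦ hinit hj' a b t
    · rw [transition_velocity_row hΦ hinit hj' a b t]
      rcases hj with rfl | rfl <;> simp
    · rw [transition_position_row hΦ hinit hj' a b t]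
      rcases hj with rfl | rfl <;> simp [Matrix.one_apply]
    · exact transition_bias_feature_row hΦ hinit hi a (j, b) t
  rw [hone]
  by_cases h : i = j <;> simp [Matrix.one_apply, h]

end TransitionMatrix

/-- Structure of the RIEKF state-transition matrix (eq. (27)): if `Φ' = F·Φ`
with `Φ(t₀) = I₁₈`, then the first block column of `Φ(t)` is
`(I₃, (t−t₀)·S g, ((t−t₀)²/2)·S g, 0, 0, 0)`, the third block column is
`(0, 0, I₃, 0, 0, 0)` and the sixth block column is `(0, 0, 0, 0, 0, I₃)`. -/
theorem riekf_transition_matrix_structure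
    (g : Fin 3 → ℝ) (Rhat : ℝ → Matrix (Fin 3) (Fin 3) ℝ)
    (vhat phat : ℝ → Fin 3 → ℝ)
    (hRc : Continuous Rhat) (hvc : Continuous vhat) (hpc : Continuous phat)
    (Φ : ℝ → Matrix (Fin 6 × Fin 3) (Fin 6 × Fin 3) ℝ) (t₀ : ℝ)
    (hΦ : ∀ t, HasDerivAt Φ (Fmat g Rhat vhat phat t * Φ t) t)
    (hinit : Φ t₀ = 1) :
    (∀ t (a b : Fin 3), Φ t (0, a) (0, b) = (1 : Matrix (Fin 3) (Fin 3) ℝ) a b) ∧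
    (∀ t (a b : Fin 3), Φ t (1, a) (0, b) = ((t - t₀) • Smat g) a b) ∧
    (∀ t (a b : Fin 3), Φ t (2, a) (0, b) = (((t - t₀) ^ 2 / 2) • Smat g) a b) ∧
    (∀ t (i : Fin 6) (a b : Fin 3), i = 3 ∨ i = 4 ∨ i = 5 →
      Φ t (i, a) (0, b) = 0) ∧
    (∀ t (i : Fin 6) (a b : Fin 3),
      Φ t (i, a) (2, b) = (if i = 2 then (1 : Matrix (Fin 3) (Fin 3) ℝ) else 0) a b) ∧
    (∀ t (i : Fin 6) (a b : Fin 3),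
      Φ t (i, a) (5, b) = (if i = 5 then (1 : Matrix (Fin 3) (Fin 3) ℝ) else 0) a b) := by
  refine ⟨fun t a b => ?_, fun t a b => ?_, fun t a b => ?_, fun t i a b hi => ?_,
    fun t i a b => transition_position_feature_column hΦ hinit (Or.inl rfl) i a b t,
    fun t i a b => transition_position_feature_column hΦ hinit (Or.inr rfl) i a b t⟩
  · rw [transition_rotation_row hΦ hinit (by decide)]
    simp [Matrix.one_apply]
  · rw [transition_velocity_row hΦ hinit (by decide)]
    simp [Matrix.one_apply]
  · rw [transition_position_row hΦ hinit (by decide)]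
    simp [Matrix.one_apply]
  · rw [transition_bias_feature_row hΦ hinit hi]
    rcases hi with rfl | rfl | rfl <;> simp
end

section
/- (RIEKF-VINS satisfies the invariance condition (14): H·Φ·N = 0.) Let g ∈ ℝ³, let F(t) be the 18×18 RIEKF propagation Jacobian (block rows/columns ordered θ, v, p, b_g, b_a, f): block row 1 = [0, 0, 0, −R̂(t), 0, 0]; block row 2 = [S(g), 0, 0, −S(v̂(t))·R̂(t), −R̂(t), 0]; block row 3 = [0, I₃, 0, −S(p̂(t))·R̂(t), 0, 0]; block rows 4, 5, 6 = 0, with R̂, v̂, p̂ continuous, and let N be the 18×4 matrix with block rows (g, 0₃ₓ₃), (0, 0₃ₓ₃), (0, I₃), (0, 0₃ₓ₃), (0, 0₃ₓ₃), (0, I₃). Suppose Φ : ℝ → Matrix(18,18,ℝ) is differentiable with Φ'(t) = F(t)·Φ(t) and Φ(t₀)·N = N. Then for every 3×3 real matrix D and every 3×3 real matrix R̄, the RIEKF measurement Jacobian H := D·[0₃ₓ₃, 0₃ₓ₃, −R̄ᵀ, 0₃ₓ₃, 0₃ₓ₃, R̄ᵀ] (a 3×18 matrix in 3×3 blocks)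 satisfies H·Φ(t)·N = 0 for all t. -/
open Matrix

attribute [local instance] Matrix.normedAddCommGroup Matrix.normedSpace

/-- The RIEKF measurement Jacobian `H = D·[0, 0, −R̄ᵀ, 0, 0, R̄ᵀ]` (eq. (22)),
a 3×18 matrix in 3×3 blocks. -/
def Hmat (D Rbar : Matrix (Fin 3) (Fin 3) ℝ) :
    Matrix (Fin 3) (Fin 6 × Fin 3) ℝ :=
  fun a q => (D * (if q.1 = 2 then -Rbarᵀ else if q.1 = 5 then Rbarᵀ else 0)) a q.2

theorem Smat_mulVec_self (x : Fin 3 → ℝ) : Smat x *ᵥ x = 0 := by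
  ext i
  fin_cases i <;> simp [Smat, mulVec, dotProduct, Fin.sum_univ_three] <;> ring

theorem Fmat_mul_apply {n : Type*} (g : Fin 3 → ℝ) (R : ℝ → Matrix (Fin 3) (Fin 3) ℝ)
    (v p : ℝ → Fin 3 → ℝ) (t : ℝ) (M : Matrix (Fin 6 × Fin 3) n ℝ) (i : Fin 6) (k : Fin 3)
    (c : n) :
    (Fmat g R v p t * M) (i, k) c =
      ∑ j, (Fblock g (R t) (v t) (p t) i j *ᵥ fun l => M (j, l) c) k := by
  simp [Matrix.mul_apply, Fintype.sum_prod_type, Fmat, mulVec, dotProduct]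

theorem Matrix.hasDerivAt_mul_const_apply {l m n : Type*} [Fintype l] [Fintype m]
    {A : ℝ → Matrix l m ℝ} {A' : Matrix l m ℝ} {t : ℝ} (hA : HasDerivAt A A' t)
    (B : Matrix m n ℝ) (i : l) (j : n) :
    HasDerivAt (fun s => (A s * B) i j) ((A' * B) i j) t := by
  simp only [Matrix.mul_apply]
  exact HasDerivAt.fun_sum fun k _ =>
    (hasDerivAt_pi.1 (hasDerivAt_pi.1 hA i) k).mul_const (B k j)

/-- The unobservable directions are fixed by every transition matrix of the propagation: the
bias and feature blocks of `Φ N` are constant, hence so are the `θ`, `v`, `p` blocks in turn. -/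
theorem transition_mul_Nmat
    {g : Fin 3 → ℝ} {R : ℝ → Matrix (Fin 3) (Fin 3) ℝ} {v p : ℝ → Fin 3 → ℝ}
    {Φ : ℝ → Matrix (Fin 6 × Fin 3) (Fin 6 × Fin 3) ℝ} {t₀ : ℝ}
    (hΦ : ∀ t, HasDerivAt Φ (Fmat g R v p t * Φ t) t)
    (hinit : Φ t₀ * Nmat g = Nmat g) (t : ℝ) : Φ t * Nmat g = Nmat g := by
  have block_const (i : Fin 6)
      (h : ∀ s k c, (Fmat g R v p s * (Φ s * Nmat g)) (i, k) c = 0) (s : ℝ) (k : Fin 3)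
      (c : Fin 4) : (Φ s * Nmat g) (i, k) c = Nmat g (i, k) c := by
    have hd (r : ℝ) : HasDerivAt (fun s => (Φ s * Nmat g) (i, k) c) 0 r := by
      simpa only [Matrix.mul_assoc, h] using
        Matrix.hasDerivAt_mul_const_apply (hΦ r) (Nmat g) (i, k) c
    rw [← congrFun₂ hinit (i, k) c]
    exact is_const_of_deriv_eq_zero (fun r => (hd r).differentiableAt)
      (fun r => (hd r).deriv) s t₀
  have hbg := block_const 3 fun s k c => by
    simp [Fmat_mul_apply, Fblock]
  have hba := block_const 4 fun s k c => by
    simp [Fmat_mul_apply, Fblock]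
  have hf := block_const 5 fun s k c => by
    simp [Fmat_mul_apply, Fblock]
  have hbg_zero (k : Fin 3) (c : Fin 4) : Nmat g (3, k) c = 0 := by simp [Nmat]
  have hba_zero (k : Fin 3) (c : Fin 4) : Nmat g (4, k) c = 0 := by simp [Nmat]
  have hv_zero (k : Fin 3) (c : Fin 4) : Nmat g (1, k) c = 0 := by simp [Nmat]
  have zero_fun : (fun _ : Fin 3 => (0 : ℝ)) = 0 := rfl
  have hθ := block_const 0 fun s k c => by
    simp [Fmat_mul_apply, Fblock, Fin.sum_univ_six, hbg, hbg_zero, zero_fun]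
  have hSθ (c : Fin 4) : (Smat g *ᵥ fun l => Nmat g (0, l) c) = 0 := by
    by_cases hc : c = 0
    · simpa [Nmat, hc] using Smat_mulVec_self g
    · simp [Nmat, hc, zero_fun]
  have hv := block_const 1 fun s k c => by
    simp [Fmat_mul_apply, Fblock, Fin.sum_univ_six, hbg, hbg_zero, hba, hba_zero, hθ, hSθ,
      zero_fun]
  have hp := block_const 2 fun s k c => by
    simp [Fmat_mul_apply, Fblock, Fin.sum_univ_six, hbg, hbg_zero, hv, hv_zero, zero_fun]
  ext ⟨i, k⟩ c
  fin_cases i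
  exacts [hθ t k c, hv t k c, hp t k c, hbg t k c, hba t k c, hf t k c]

/-- The position and feature blocks of the measurement Jacobian cancel on `N`. -/
theorem Hmat_mul_Nmat (D Rbar : Matrix (Fin 3) (Fin 3) ℝ) (g : Fin 3 → ℝ) :
    Hmat D Rbar * Nmat g = 0 := by
  ext a c
  by_cases hc : c = 0 <;>
    simp [Matrix.mul_apply (M := Hmat D Rbar), Fintype.sum_prod_type, Fin.sum_univ_six, Hmat,
      Nmat, hc, ← Finset.sum_add_distrib, ← ite_add_zero]

/-- RIEKF-VINS satisfies the invariance condition (14): `H·Φ(t)·N = 0`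
for every measurement Jacobian `H` of the RIEKF form. -/
theorem riekf_satisfies_invariance_condition
    (g : Fin 3 → ℝ) (Rhat : ℝ → Matrix (Fin 3) (Fin 3) ℝ)
    (vhat phat : ℝ → Fin 3 → ℝ)
    (hRc : Continuous Rhat) (hvc : Continuous vhat) (hpc : Continuous phat)
    (Φ : ℝ → Matrix (Fin 6 × Fin 3) (Fin 6 × Fin 3) ℝ) (t₀ : ℝ)
    (hΦ : ∀ t, HasDerivAt Φ (Fmat g Rhat vhat phat t * Φ t) t)
    (hinit : Φ t₀ * Nmat g = Nmat g) :
    ∀ (D Rbar : Matrix (Fin 3) (Fin 3) ℝ) (t : ℝ),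
      Hmat D Rbar * Φ t * Nmat g = 0 := by
  intro D Rbar t
  rw [Matrix.mul_assoc, transition_mul_Nmat hΦ hinit, Hmat_mul_Nmat]
end

section
/- (Update step under a stochastic identity transformation; step in the proof of Theorem 3.) Let P be an n×n real matrix, H an m×n real matrix with m, n, k positive, M an n×k real matrix with H·M = 0, Σ a k×k real matrix, and V an m×m real matrix such that S := H·P·Hᵀ + V is invertible. Set P' := P + M·Σ·Mᵀ. Then: (i) H·P'·Hᵀ = H·P·Hᵀ, so H·P'·Hᵀ + V = S is invertible; (ii) the Kalman gain is unchanged, K' := P'·Hᵀ·(H·P'·Hᵀ + V)⁻¹ = P·Hᵀ·S⁻¹ =: K; and (iii) the updated covariance satisfies (I − K'·H)·P' = (I − K·H)·P + M·Σ·Mᵀ. -/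
open Matrix

/-- Update step under a stochastic identity transformation (step in the proof of
Theorem 3): if `H·M = 0` and the covariance is inflated to `P' = P + M·Sig·Mᵀ`,
then the innovation covariance and Kalman gain are unchanged and the updated
covariance satisfies `(I − K'·H)·P' = (I − K·H)·P + M·Sig·Mᵀ`. -/
theorem update_stochastic_identity_transformation
    (n m k : ℕ) (hn : 0 < n) (hm : 0 < m) (hk : 0 < k)
    (P : Matrix (Fin n) (Fin n) ℝ) (H : Matrix (Fin m) (Fin n) ℝ)
    (M : Matrix (Fin n) (Fin k) ℝ) (hHM : H * M = 0)
    (Sig : Matrix (Fin k) (Fin k) ℝ) (V : Matrix (Fin m) (Fin m) ℝ)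
    (S : Matrix (Fin m) (Fin m) ℝ) (hS : S = H * P * Hᵀ + V)
    (hSinv : IsUnit S.det)
    (K : Matrix (Fin n) (Fin m) ℝ) (hK : K = P * Hᵀ * S⁻¹)
    (P' : Matrix (Fin n) (Fin n) ℝ) (hP' : P' = P + M * Sig * Mᵀ)
    (K' : Matrix (Fin n) (Fin m) ℝ) (hK' : K' = P' * Hᵀ * (H * P' * Hᵀ + V)⁻¹) :
    H * P' * Hᵀ = H * P * Hᵀ ∧ IsUnit (H * P' * Hᵀ + V).det ∧
    K' = K ∧ (1 - K' * H) * P' = (1 - K * H) * P + M * Sig * Mᵀ := by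
  have hMH : Mᵀ * Hᵀ = 0 := by rw [← transpose_mul, hHM, transpose_zero]
  have hHP' : H * P' = H * P := by
    rw [hP', Matrix.mul_add, Matrix.mul_assoc M, ← Matrix.mul_assoc H, hHM, Matrix.zero_mul,
      add_zero]
  have hP'H : P' * Hᵀ = P * Hᵀ := by
    rw [hP', Matrix.add_mul, Matrix.mul_assoc (M * Sig), hMH, Matrix.mul_zero, add_zero]
  have hKK : K' = K := by rw [hK', hK, hHP', hP'H, hS]
  refine ⟨by rw [hHP'], by rwa [hHP', ← hS], hKK, ?_⟩
  rw [hKK, Matrix.sub_mul, Matrix.sub_mul, Matrix.mul_assoc, hHP', Matrix.mul_assoc K,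
    Matrix.one_mul, Matrix.one_mul, hP']
  abel
end
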